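/- (Proposition: twisted duality at the level of complexes.) For all 0 ≤ k ≤ n−1 and all P ∈ χ^k(R), the following equality holds in M ⊗_R Ω^{n−k−1}(R): († ∘ δ_k)(P) = (−1)^{k+1} (∂_{n−k} ∘ †)(P). Consequently the diagram formed by δ_k : χ^k(R) → χ^{k+1}(R), (−1)^{k+1}∂_{n−k} : M ⊗_R Ω^{n−k}(R) → M ⊗_R Ω^{n−k−1}(R) and the vertical isomorphisms † commutes. -/

import Mathlib

open MvPolynomial

noncomputable section

abbrev Rp (n : ℕ) := MvPolynomial (Fin n) ℂ

abbrev cIdx (n : ℕ) (k : ℤ) := {s : Finset (Fin n) // (s.card : ℤ) = k}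

/-- `C_k = M ⊗_R Ω^k(R)`: free `R`-module on the increasing wedges `dX_S`. -/
abbrev Ch (n : ℕ) (k : ℤ) := cIdx n k → Rp n

/-- The Poisson bracket on `ℂ[X_1,…,X_n]` with `{X i, X j} = a i j • X i X j`. -/
def pb {n : ℕ} (a : Fin n → Fin n → ℤ) (f g : Rp n) : Rp n :=
  ∑ i : Fin n, ∑ j : Fin n,
    C ((a i j : ℂ)) * X i * X j * pderiv i f * pderiv j g

/-- `m ↦ {m, X u}_M = −{X u, m} + D(X u)·m`, as a ℂ-linear map. -/
def bML {n : ℕ} (a : Fin n → Fin n → ℤ) (u : Fin n) : Rp n →ₗ[ℂ] Rp n :=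
  LinearMap.mulLeft ℂ (C (∑ l : Fin n, (a u l : ℂ)) * X u)
    - ∑ j : Fin n, (LinearMap.mulLeft ℂ (C ((a u j : ℂ)) * X u * X j)).comp
        (pderiv j).toLinearMap

/-- Boundary of the Poisson homology complex of `R` with values in `M` (the true
boundary `C_j → C_{j-1}` when `k = j − 1`), written on the basis `m ⊗ dX_S`. -/
def bnd {n : ℕ} (a : Fin n → Fin n → ℤ) (j k : ℤ) : Ch n j →ₗ[ℂ] Ch n k :=
  LinearMap.pi fun T : cIdx n k =>
    ∑ u : Fin n,
      if u ∈ T.1 then 0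
      else if hc : ((insert u T.1).card : ℤ) = j then
        ((-1 : ℂ) ^ ((T.1.filter (fun w => w < u)).card)) •
          ((bML a u + (∑ w ∈ T.1, (a w u : ℂ)) • LinearMap.mulLeft ℂ (X u)).comp
            (LinearMap.proj (⟨insert u T.1, hc⟩ : cIdx n j)))
      else 0

/-- `P ∈ χ^k(R)`: multilinear, skew-symmetric, derivation in each argument. -/
def IsChi {n k : ℕ} (P : (Fin k → Rp n) → Rp n) : Prop :=
  (∀ (v : Fin k → Rp n) (i : Fin k) (x y : Rp n),
      P (Function.update v i (x + y)) = P (Function.update v i x) + P (Function.update v i y)) ∧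
  (∀ (v : Fin k → Rp n) (i : Fin k) (c : ℂ) (x : Rp n),
      P (Function.update v i (c • x)) = c • P (Function.update v i x)) ∧
  (∀ (v : Fin k → Rp n) (g : Equiv.Perm (Fin k)),
      P (v ∘ g) = ((Equiv.Perm.sign g : ℤ) : ℂ) • P v) ∧
  (∀ (v : Fin k → Rp n) (i : Fin k) (x y : Rp n),
      P (Function.update v i (x * y)) = x * P (Function.update v i y) + y * P (Function.update v i x))

/-- The `(m+1)`-st element (0-based `m`-th) of `{0,…,k}` with `i` and `j` removed. -/
def cmpl {k : ℕ} (i j : Fin (k + 1)) (m : ℕ) : Fin (k + 1) :=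
  (((List.finRange (k + 1)).filter (fun x : Fin (k + 1) => decide (x ≠ i ∧ x ≠ j)))).getD m i

/-- The Poisson coboundary `δ_k : χ^k(R) → χ^{k+1}(R)`,
`δP(f_0,…,f_k) = ∑ (−1)^i {f_i, P(…omit f_i…)} + ∑_{i<j} (−1)^{i+j} P({f_i,f_j},…omit f_i,f_j…)`
(0-based indices, as in the paper). -/
def dlt {n k : ℕ} (a : Fin n → Fin n → ℤ) (P : (Fin k → Rp n) → Rp n) :
    (Fin (k + 1) → Rp n) → Rp n := fun f =>
  (∑ i : Fin (k + 1), (-1 : ℂ) ^ (i : ℕ) • pb a (f i) (P (f ∘ i.succAbove)))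
  + ∑ i : Fin (k + 1), ∑ j : Fin (k + 1),
      if i < j then
        (-1 : ℂ) ^ ((i : ℕ) + (j : ℕ)) •
          P (fun l : Fin k =>
            if (l : ℕ) = 0 then pb a (f i) (f j) else f (cmpl i j ((l : ℕ) - 1)))
      else 0

/-- `S_{k,n-k}`: permutations increasing on (0-based) positions `0,…,k-1` and
`k,…,n-1`. -/
def Skn (n k : ℕ) (σ : Equiv.Perm (Fin n)) : Prop :=
  (∀ p q : Fin n, p < q → (q : ℕ) < k → σ p < σ q) ∧
  (∀ p q : Fin n, p < q → k ≤ (p : ℕ) → σ p < σ q)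

instance (n k : ℕ) : DecidablePred (Skn n k) := fun σ => by unfold Skn; infer_instance

/-- sign of a permutation, as a complex number. -/
def sgnC {m : ℕ} (σ : Equiv.Perm (Fin m)) : ℂ := ((Equiv.Perm.sign σ : ℤ) : ℂ)

/-- The isomorphism `† : χ^k(R) → M ⊗_R Ω^{n−k}(R)`,
`†(P) = ∑_{σ ∈ S_{k,n−k}} ε(σ) P(X_{σ(1)},…,X_{σ(k)}) ⊗ dX_{σ(k+1)} ∧ ⋯ ∧ dX_{σ(n)}`
(`dag d k _ P` lands in `C_d`; it is `†` when `d = n − k`). -/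
def dag {n : ℕ} (d : ℤ) (k : ℕ) (hk : k ≤ n) (P : (Fin k → Rp n) → Rp n) : Ch n d :=
  fun T => ∑ σ ∈ Finset.univ.filter (Skn n k),
    if T.1 = Finset.image (fun t : Fin (n - k) => σ ⟨k + (t : ℕ), by omega⟩) Finset.univ
    then sgnC σ • P (fun l : Fin k => X (σ (Fin.castLE hk l)))
    else 0

theorem val_cycleIcc {n : ℕ} {i j : Fin n} (hij : i ≤ j) (p : Fin n) :
    (Fin.cycleIcc i j p : ℕ) =
      if i ≤ p ∧ p < j then (p : ℕ) + 1 else if p = j then (i : ℕ) else p := by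
  have : NeZero n := ⟨by have := p.2; omega⟩
  rcases lt_or_ge p i with h | h
  · rw [Fin.cycleIcc_of_lt h, if_neg (by grind), if_neg (by grind)]
  rcases lt_trichotomy p j with h' | h' | h'
  · rw [Fin.cycleIcc_of_ge_of_lt h h', if_pos ⟨h, h'⟩]
    exact Fin.val_add_one_of_lt' (by omega)
  · subst h'
    rw [Fin.cycleIcc_of_last hij]
    simp
  · rw [Fin.cycleIcc_of_gt h', if_neg (by grind), if_neg (by grind)]

theorem sgnC_mul_cycleIcc {n : ℕ} (σ : Equiv.Perm (Fin n)) {i j : Fin n} (hij : i ≤ j) :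
    sgnC (σ * Fin.cycleIcc i j) = sgnC σ * (-1) ^ ((i : ℕ) + j) := by
  simp only [sgnC, Equiv.Perm.sign_mul, Fin.sign_cycleIcc_of_le hij]
  obtain ⟨d, hd⟩ := Nat.exists_eq_add_of_le (Fin.le_def.mp hij)
  rw [hd, Nat.add_sub_cancel_left, ← add_assoc, pow_add _ ((i : ℕ) + i), Even.neg_one_pow ⟨_, rfl⟩]
  simp

/-- A shuffle is determined by the set of values it takes on its last block. -/
theorem Skn.unique {n k : ℕ} {σ τ : Equiv.Perm (Fin n)} (hσ : Skn n k σ) (hτ : Skn n k τ)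
    {T : Finset (Fin n)} (hσT : ∀ p, σ p ∈ T ↔ k ≤ (p : ℕ)) (hτT : ∀ p, τ p ∈ T ↔ k ≤ (p : ℕ)) :
    σ = τ := by
  have hg : ∀ p : Fin n, k ≤ (p : ℕ) ↔ k ≤ (τ.symm (σ p) : ℕ) := fun p => by
    rw [← hσT, ← hτT, Equiv.apply_symm_apply]
  have hmono : StrictMono (σ.trans τ.symm) := by
    intro p q hpq
    by_contra! h
    have hne : (σ.trans τ.symm) q ≠ (σ.trans τ.symm) p :=
      fun e => hpq.ne ((σ.trans τ.symm).injective e).symm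
    have hlt := lt_of_le_of_ne h hne
    simp only [Equiv.trans_apply] at hlt
    by_cases hp : k ≤ (p : ℕ)
    · have h1 := hσ.2 p q hpq hp
      have h2 := hτ.2 _ _ hlt ((hg q).1 (by omega))
      simp only [Equiv.apply_symm_apply] at h2
      exact lt_asymm h1 h2
    · have hp' := mt (hg p).2 hp
      by_cases hq : k ≤ (q : ℕ)
      · have := (hg q).1 hq
        omega
      · have h1 := hσ.1 p q hpq (by omega)
        have h2 := hτ.1 _ _ hlt (by omega)
        simp only [Equiv.apply_symm_apply] at h2
        exact lt_asymm h1 h2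
  have hid : ∀ p, (σ.trans τ.symm) p = p := fun p => by
    have := congrArg (fun e : Fin n ≃o Fin n => e p)
      (Subsingleton.elim (hmono.orderIsoOfSurjective _ (σ.trans τ.symm).surjective)
        (OrderIso.refl _))
    simpa using this
  ext p
  have := hid p
  rw [Equiv.trans_apply, Equiv.symm_apply_eq] at this
  rw [this]

theorem mem_image_tail_iff {n k : ℕ} (hk : k ≤ n) (σ : Equiv.Perm (Fin n)) (p : Fin n) :
    σ p ∈ Finset.image (fun t : Fin (n - k) => σ ⟨k + (t : ℕ), by omega⟩) Finset.univ ↔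
      k ≤ (p : ℕ) := by
  simp only [Finset.mem_image, Finset.mem_univ, true_and, EmbeddingLike.apply_eq_iff_eq]
  constructor
  · rintro ⟨t, rfl⟩
    simp
  · intro h
    exact ⟨⟨p - k, by omega⟩, by ext; simp; omega⟩

theorem dag_apply {n k : ℕ} {d : ℤ} (hk : k ≤ n) (P : (Fin k → Rp n) → Rp n) (T : cIdx n d)
    {σ : Equiv.Perm (Fin n)} (hσ : Skn n k σ) (hσT : ∀ p, σ p ∈ T.1 ↔ k ≤ (p : ℕ)) :
    dag d k hk P T = sgnC σ • P (fun l => X (σ (Fin.castLE hk l))) := by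
  have himage : T.1 =
      Finset.image (fun t : Fin (n - k) => σ ⟨k + (t : ℕ), by omega⟩) Finset.univ := by
    ext x
    obtain ⟨p, rfl⟩ := σ.surjective x
    rw [hσT, mem_image_tail_iff hk]
  unfold dag
  rw [Finset.sum_eq_single σ]
  · rw [if_pos himage]
  · intro τ hτ hne
    refine if_neg fun h => hne ?_
    refine Skn.unique (Finset.mem_filter.1 hτ).2 hσ (T := T.1) (fun p => ?_) hσT
    rw [h, mem_image_tail_iff hk]
  · intro h
    exact absurd (Finset.mem_filter.2 ⟨Finset.mem_univ _, hσ⟩) h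

theorem exists_shuffle {n k : ℕ} (T : Finset (Fin n)) (hT : T.card + k = n) :
    ∃ σ : Equiv.Perm (Fin n), Skn n k σ ∧ ∀ p, σ p ∈ T ↔ k ≤ (p : ℕ) := by
  have hc : (Tᶜ).card = k := by
    rw [Finset.card_compl, Fintype.card_fin]
    omega
  let f : Fin n → Fin n := fun p =>
    if h : (p : ℕ) < k then Tᶜ.orderEmbOfFin hc ⟨p, h⟩
    else T.orderEmbOfFin rfl ⟨p - k, by omega⟩
  have hlo : ∀ (p : Fin n) (h : (p : ℕ) < k), f p = Tᶜ.orderEmbOfFin hc ⟨p, h⟩ := fun p h => dif_pos h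
  have hhi : ∀ (p : Fin n) (h : k ≤ (p : ℕ)), f p = T.orderEmbOfFin rfl ⟨p - k, by omega⟩ :=
    fun p h => dif_neg (by omega)
  have hmem : ∀ p : Fin n, f p ∈ T ↔ k ≤ (p : ℕ) := by
    intro p
    rcases lt_or_ge (p : ℕ) k with h | h
    · have := Tᶜ.orderEmbOfFin_mem hc ⟨p, h⟩
      rw [← hlo p h, Finset.mem_compl] at this
      simp only [this, false_iff]
      omega
    · have := T.orderEmbOfFin_mem rfl ⟨p - k, by omega⟩
      rw [← hhi p h] at this
      simp only [this, h]
  have hf1 : ∀ p q : Fin n, p < q → (q : ℕ) < k → f p < f q := by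
    intro p q hpq hq
    rw [hlo p (by omega), hlo q hq]
    simpa using hpq
  have hf2 : ∀ p q : Fin n, p < q → k ≤ (p : ℕ) → f p < f q := by
    intro p q hpq hp
    rw [hhi p hp, hhi q (by omega)]
    simp only [OrderEmbedding.lt_iff_lt, Fin.mk_lt_mk]
    omega
  have hinj : Function.Injective f := by
    intro p q hpq
    have hiff : k ≤ (p : ℕ) ↔ k ≤ (q : ℕ) := by rw [← hmem, ← hmem, hpq]
    by_contra hne
    rcases lt_or_gt_of_ne hne with h | h <;> rcases lt_or_ge (q : ℕ) k with h' | h'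
    · exact (hf1 _ _ h h').ne hpq
    · exact (hf2 _ _ h (by omega)).ne hpq
    · exact (hf1 _ _ h (by omega)).ne' hpq
    · exact (hf2 _ _ h (by omega)).ne' hpq
  exact ⟨Equiv.ofBijective f (Finite.injective_iff_bijective.1 hinj), ⟨hf1, hf2⟩, hmem⟩

/-- On the last block, the values of a shuffle below `u` are taken at the initial positions. -/
theorem Skn.apply_lt_iff {n k : ℕ} {σ : Equiv.Perm (Fin n)} (hσ : Skn n k σ)
    {T : Finset (Fin n)} (hσT : ∀ p, σ p ∈ T ↔ k ≤ (p : ℕ)) (u p : Fin n) (hp : k ≤ (p : ℕ)) :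
    σ p < u ↔ (p : ℕ) < k + (T.filter (fun w => w < u)).card := by
  let o : Fin n := ⟨k, by omega⟩
  constructor
  · intro h
    have hsub : (Finset.Icc o p).map σ.toEmbedding ⊆ T.filter (fun w => w < u) := by
      intro x hx
      obtain ⟨q, hq, rfl⟩ := Finset.mem_map.1 hx
      obtain ⟨h1, h2⟩ := Finset.mem_Icc.1 hq
      refine Finset.mem_filter.2 ⟨(hσT q).2 h1, lt_of_le_of_lt ?_ h⟩
      rcases h2.lt_or_eq with h2 | rfl
      · exact (hσ.2 _ _ h2 h1).le
      · exact le_rfl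
    have := Finset.card_le_card hsub
    rw [Finset.card_map, Fin.card_Icc] at this
    simp only [o] at this
    omega
  · intro h
    by_contra! hu
    have hsub : T.filter (fun w => w < u) ⊆ (Finset.Ico o p).map σ.toEmbedding := by
      intro x hx
      obtain ⟨q, rfl⟩ := σ.surjective x
      obtain ⟨h1, h2⟩ := Finset.mem_filter.1 hx
      refine Finset.mem_map_of_mem σ.toEmbedding (Finset.mem_Ico.2 ⟨(hσT q).1 h1, ?_⟩)
      by_contra! hq
      rcases hq.lt_or_eq with hq | rfl
      · exact absurd (hσ.2 _ _ hq hp) (by order)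
      · order
    have := Finset.card_le_card hsub
    rw [Finset.card_map, Fin.card_Ico] at this
    simp only [o] at this
    omega

/-- Moving the value in position `i` of the first block of a shuffle to its place in the
last block gives again a shuffle. -/
theorem Skn.mul_cycleIcc {n k : ℕ} {σ : Equiv.Perm (Fin n)} (hσ : Skn n (k + 1) σ)
    {T : Finset (Fin n)} (hσT : ∀ p, σ p ∈ T ↔ k + 1 ≤ (p : ℕ)) {i j : Fin n}
    (hi : (i : ℕ) ≤ k) (hj : (j : ℕ) = k + (T.filter (fun w => w < σ i)).card) :
    Skn n k (σ * Fin.cycleIcc i j) ∧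
      ∀ p, (σ * Fin.cycleIcc i j) p ∈ insert (σ i) T ↔ k ≤ (p : ℕ) := by
  have hij : i ≤ j := Fin.le_def.2 (by omega)
  have hv := val_cycleIcc hij
  have hlt := fun (p : Fin n) hp => hσ.apply_lt_iff hσT (σ i) p hp
  refine ⟨⟨fun p q hpq hq => ?_, fun p q hpq hp => ?_⟩, fun p => ?_⟩
  · refine hσ.1 _ _ ?_ ?_
    · rw [Fin.lt_def, hv, hv]
      grind
    · rw [hv]
      grind
  · simp only [Equiv.Perm.mul_apply]
    have hvp := hv p
    have hvq := hv q
    rcases lt_trichotomy p j with hpj | rfl | hpj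
    · rw [if_pos (by grind)] at hvp
      by_cases hqj : q = j
      · subst hqj
        rw [if_neg (by grind), if_pos rfl] at hvq
        rw [Fin.ext hvq, hlt _ (by omega)]
        omega
      · refine hσ.2 _ _ ?_ (by omega)
        grind
    · rw [if_neg (by grind), if_pos rfl] at hvp
      rw [if_neg (by grind), if_neg (by grind)] at hvq
      rw [Fin.ext hvp, Fin.ext hvq]
      have h1 := hlt q (by omega)
      refine lt_of_le_of_ne (not_lt.1 fun h => ?_) (σ.injective.ne (by grind))
      have := h1.1 h
      omega
    · refine hσ.2 _ _ ?_ ?_ <;> grind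
  · simp only [Equiv.Perm.mul_apply, Finset.mem_insert, hσT, EmbeddingLike.apply_eq_iff_eq,
      Fin.ext_iff, hv]
    grind

theorem cmpl_eq_succAbove {k : ℕ} {i j : Fin (k + 2)} (hij : i < j) (m : Fin k) :
    cmpl i j m = j.succAbove
      ((⟨i, by omega⟩ : Fin (k + 1)).succAbove m) := by
  let i' : Fin (k + 1) := ⟨i, by omega⟩
  let e : Fin k → Fin (k + 2) := fun m => j.succAbove (i'.succAbove m)
  have hi' : j.succAbove i' = i := Fin.succAbove_of_castSucc_lt _ _ hij
  have hlist : (List.finRange (k + 2)).filter (fun x => decide (x ≠ i ∧ x ≠ j)) = List.ofFn e := by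
    refine List.SortedLT.eq_of_mem_iff ?_ ?_ fun x => ?_
    · exact ((List.sortedLT_finRange _).pairwise.filter _).sortedLT
    · exact List.sortedLT_ofFn_iff.2
        ((Fin.strictMono_succAbove j).comp (Fin.strictMono_succAbove i'))
    · simp only [List.mem_filter, List.mem_finRange, true_and, decide_eq_true_eq, List.mem_ofFn, e]
      constructor
      · rintro ⟨h1, h2⟩
        obtain ⟨y, rfl⟩ := Fin.exists_succAbove_eq h2
        have hy : y ≠ i' := by
          rintro rfl
          exact h1 hi'
        obtain ⟨z, rfl⟩ := Fin.exists_succAbove_eq hy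
        exact ⟨z, rfl⟩
      · rintro ⟨z, rfl⟩
        refine ⟨fun h => ?_, Fin.succAbove_ne _ _⟩
        rw [← hi'] at h
        exact Fin.succAbove_ne _ _ (Fin.succAbove_right_injective h)
  unfold cmpl
  rw [hlist, List.getD_eq_getElem _ _ (by simp), List.getElem_ofFn]

theorem val_cmpl {k : ℕ} {i j : Fin (k + 2)} (hij : i < j) {m : ℕ} (hm : m < k) :
    (cmpl i j m : ℕ) = if m < i then m else if m + 1 < j then m + 1 else m + 2 := by
  have h := cmpl_eq_succAbove hij ⟨m, hm⟩
  rw [h]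
  simp only [Fin.succAbove, Fin.lt_def, Fin.val_castSucc]
  grind

theorem val_succAbove {k : ℕ} (i : Fin (k + 1)) (m : Fin k) :
    (i.succAbove m : ℕ) = if (m : ℕ) < i then (m : ℕ) else m + 1 := by
  simp only [Fin.succAbove, Fin.lt_def]
  grind

/-- The argument list `(y, f_0, …, f_k)` with `f_i` and `f_j` omitted, as it occurs in `dlt`. -/
def consOmit {n k : ℕ} (f : Fin (k + 1) → Rp n) (i j : Fin (k + 1)) (y : Rp n) : Fin k → Rp n :=
  fun l => if (l : ℕ) = 0 then y else f (cmpl i j ((l : ℕ) - 1))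

theorem consOmit_eq_update {n k : ℕ} (f : Fin (k + 2) → Rp n) (i j : Fin (k + 2)) (y : Rp n) :
    consOmit f i j y = Function.update (consOmit f i j 0) 0 y := by
  ext1 l
  by_cases h : l = 0
  · subst h
    simp [consOmit]
  · rw [Function.update_of_ne h]
    have h' : (l : ℕ) ≠ 0 := fun e => h (Fin.ext e)
    simp [consOmit, h']

theorem consOmit_comp_cycleIcc {n k : ℕ} (f : Fin (k + 2) → Rp n) {i j : Fin (k + 2)}
    (hij : i < j) {q : Fin (k + 1)} {r s : Fin (k + 2)}
    (hrs : r = i ∧ s = j ∧ (q : ℕ) + 1 = j ∨ r = j ∧ s = i ∧ (q : ℕ) = i) :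
    consOmit f i j (f s) ∘ Fin.cycleIcc 0 q = f ∘ r.succAbove := by
  ext1 l
  have hv := val_cycleIcc (Fin.zero_le q) l
  have hs := val_succAbove r l
  simp only [Function.comp_apply, consOmit]
  rcases lt_trichotomy l q with h | h | h
  · rw [if_pos (by grind)] at hv
    rw [if_neg (by omega)]
    congr 1
    ext
    rw [hs, val_cmpl hij (by omega)]
    grind
  · rw [if_neg (by grind), if_pos h] at hv
    rw [if_pos (by simpa using hv)]
    congr 1
    ext
    rw [hs]
    grind
  · rw [if_neg (by grind), if_neg (by grind)] at hv
    rw [if_neg (by grind)]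
    congr 1
    ext
    rw [hs, val_cmpl hij (by omega)]
    grind

theorem IsChi.consOmit_eq {n k : ℕ} {P : (Fin (k + 1) → Rp n) → Rp n} (hP : IsChi P)
    (f : Fin (k + 2) → Rp n) {i j : Fin (k + 2)} (hij : i < j) {q : Fin (k + 1)}
    {r s : Fin (k + 2)}
    (hrs : r = i ∧ s = j ∧ (q : ℕ) + 1 = j ∨ r = j ∧ s = i ∧ (q : ℕ) = i) :
    P (consOmit f i j (f s)) = (-1 : ℂ) ^ (q : ℕ) • P (f ∘ r.succAbove) := by
  have h := hP.2.2.1 (consOmit f i j (f s)) (Fin.cycleIcc 0 q)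
  rw [consOmit_comp_cycleIcc f hij hrs, Fin.sign_cycleIcc_of_le (Fin.zero_le q)] at h
  rw [h, smul_smul]
  simp [← mul_pow]

theorem pb_X_left {n : ℕ} (a : Fin n → Fin n → ℤ) (u : Fin n) (m : Rp n) :
    pb a (X u) m = ∑ j, C (a u j : ℂ) * X u * X j * pderiv j m := by
  unfold pb
  rw [Finset.sum_eq_single u]
  · simp
  · intro i _ hi
    simp [pderiv_X_of_ne hi.symm]
  · simp

theorem pb_X_X {n : ℕ} (a : Fin n → Fin n → ℤ) (u v : Fin n) :
    pb a (X u) (X v) = (a u v : ℂ) • (X u * X v : Rp n) := by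
  rw [pb_X_left, Finset.sum_eq_single v]
  · simp [smul_eq_C_mul, mul_assoc]
  · intro i _ hi
    simp [pderiv_X_of_ne hi.symm]
  · simp

theorem bML_apply {n : ℕ} (a : Fin n → Fin n → ℤ) (u : Fin n) (m : Rp n) :
    bML a u m = (∑ l, (a u l : ℂ)) • (X u * m) - pb a (X u) m := by
  rw [pb_X_left]
  simp [bML, smul_eq_C_mul, mul_assoc]

/-- The value of `δ P` on a pair of coordinates inserted in the first slot. -/
theorem IsChi.consOmit_pb {n k : ℕ} (a : Fin n → Fin n → ℤ) (ha : ∀ i j, a j i = - a i j)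
    {P : (Fin k → Rp n) → Rp n} (hP : IsChi P) (v : Fin (k + 1) → Fin n)
    {i j : Fin (k + 1)} (hij : i < j) :
    (-1 : ℂ) ^ ((i : ℕ) + (j : ℕ)) •
        P (consOmit (fun l => X (v l)) i j (pb a (X (v i)) (X (v j)))) =
      -((-1 : ℂ) ^ (i : ℕ) • (a (v i) (v j) : ℂ) •
          (X (v i) * P ((fun l => X (v l)) ∘ i.succAbove)))
      + -((-1 : ℂ) ^ (j : ℕ) • (a (v j) (v i) : ℂ) •
          (X (v j) * P ((fun l => X (v l)) ∘ j.succAbove))) := by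
  obtain _ | k := k
  · exact absurd hij (by omega)
  obtain ⟨q, hq⟩ : ∃ q, (j : ℕ) = q + 1 := Nat.exists_eq_add_one.2 (by omega)
  have hj := hP.consOmit_eq (fun l => (X (v l) : Rp n)) hij (q := ⟨q, by omega⟩) (r := i) (s := j)
    (Or.inl ⟨rfl, rfl, hq.symm⟩)
  have hi := hP.consOmit_eq (fun l => (X (v l) : Rp n)) hij (q := ⟨i, by omega⟩) (r := j) (s := i)
    (Or.inr ⟨rfl, rfl, rfl⟩)
  rw [consOmit_eq_update] at hi hj
  rw [pb_X_X, consOmit_eq_update, hP.2.1, hP.2.2.2, hi, hj, ha (v i) (v j), hq]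
  simp only [smul_eq_C_mul, pow_add, pow_one, Int.cast_neg, map_mul, map_neg, map_pow, map_one]
  have h1 : ((-1 : Rp n) ^ q) ^ 2 = 1 := by rw [← pow_mul, mul_comm, pow_mul]; simp
  have h2 : ((-1 : Rp n) ^ (i : ℕ)) ^ 2 = 1 := by rw [← pow_mul, mul_comm, pow_mul]; simp
  grind

theorem sum_ite_lt_add_swap {ι M : Type*} [Fintype ι] [LinearOrder ι] [AddCommMonoid M]
    (G : ι → ι → M) (hG : ∀ i, G i i = 0) :
    ∑ i, ∑ j, (if i < j then G i j + G j i else 0) = ∑ i, ∑ j, G i j := by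
  have hsplit : ∀ i j, G i j = (if i < j then G i j else 0) + (if j < i then G i j else 0) := by
    intro i j
    rcases lt_trichotomy i j with h | rfl | h
    · simp [h, h.not_gt]
    · simp [hG]
    · simp [h, h.not_gt]
  have hadd : ∀ i j, (if i < j then G i j + G j i else 0) =
      (if i < j then G i j else 0) + (if i < j then G j i else 0) := by
    intro i j
    split_ifs <;> simp
  rw [Finset.sum_congr rfl fun i _ => Finset.sum_congr rfl fun j _ => hsplit i j]
  simp only [hadd, Finset.sum_add_distrib]
  rw [Finset.sum_comm (f := fun i j => if i < j then G j i else 0)]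

/-- The coboundary of a multiderivation evaluated on coordinates. -/
theorem IsChi.dlt_X {n k : ℕ} (a : Fin n → Fin n → ℤ) (ha : ∀ i j, a j i = - a i j)
    {P : (Fin k → Rp n) → Rp n} (hP : IsChi P) (v : Fin (k + 1) → Fin n) :
    dlt a P (fun l => X (v l)) = ∑ i : Fin (k + 1), (-1 : ℂ) ^ (i : ℕ) •
      (pb a (X (v i)) (P fun l => X (v (i.succAbove l)))
        - (∑ j, (a (v i) (v j) : ℂ)) • (X (v i) * P fun l => X (v (i.succAbove l)))) := by
  have haii : ∀ u, a u u = 0 := fun u => by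
    have := ha u u
    omega
  let G : Fin (k + 1) → Fin (k + 1) → Rp n := fun i j =>
    -((-1 : ℂ) ^ (i : ℕ) • (a (v i) (v j) : ℂ) •
      (X (v i) * P ((fun l => X (v l)) ∘ i.succAbove)))
  have hG := sum_ite_lt_add_swap G fun i => by simp [G, haii]
  have hsum : ∑ i : Fin (k + 1), ∑ j : Fin (k + 1), (if i < j then
        (-1 : ℂ) ^ ((i : ℕ) + (j : ℕ)) •
          P (consOmit (fun l => X (v l)) i j (pb a (X (v i)) (X (v j)))) else 0) =
      ∑ i, ∑ j, G i j := by
    rw [← hG]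
    refine Finset.sum_congr rfl fun i _ => Finset.sum_congr rfl fun j _ => ?_
    split_ifs with h
    · exact hP.consOmit_pb a ha v h
    · rfl
  unfold consOmit at hsum
  unfold dlt
  rw [hsum, ← Finset.sum_add_distrib]
  refine Finset.sum_congr rfl fun i _ => ?_
  simp only [G, smul_sub, Finset.sum_smul, Finset.smul_sum, Finset.sum_neg_distrib]
  rw [sub_eq_add_neg]
  rfl

theorem sum_add_sum_mem_eq {n m : ℕ} (a : Fin n → Fin n → ℤ) (ha : ∀ i j, a j i = - a i j)
    (T : Finset (Fin n)) (v : Fin m → Fin n) (hv : Function.Injective v)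
    (hvT : ∀ x, x ∉ T ↔ x ∈ Set.range v) (u : Fin n) :
    ∑ l, (a u l : ℂ) + ∑ w ∈ T, (a w u : ℂ) = ∑ j, (a u (v j) : ℂ) := by
  have himage : Tᶜ = Finset.univ.image v := by
    ext x
    rw [Finset.mem_compl, hvT]
    simp
  rw [← Finset.sum_add_sum_compl T, himage, Finset.sum_image fun _ _ _ _ h => hv h,
    add_right_comm, ← Finset.sum_add_distrib]
  simp [ha u]

/-- twisted duality at the level of complexes: for `0 ≤ k ≤ n−1` and
`P ∈ χ^k(R)`, one has `(† ∘ δ_k)(P) = (−1)^{k+1} (∂_{n−k} ∘ †)(P)` in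
`M ⊗_R Ω^{n−k−1}(R)`; consequently the diagram formed by `δ_k`, `(−1)^{k+1} ∂_{n−k}`
and the isomorphisms `†` commutes. -/
theorem dagger_delta_eq_sign_boundary_dagger
    (n : ℕ) (a : Fin n → Fin n → ℤ) (ha : ∀ i j, a j i = - a i j)
    (k : ℕ) (hk : k + 1 ≤ n)
    (P : (Fin k → Rp n) → Rp n) (hP : IsChi P) :
    dag ((n : ℤ) - k - 1) (k + 1) hk (dlt a P)
      = (-1 : ℂ) ^ (k + 1) •
          bnd a ((n : ℤ) - k) ((n : ℤ) - k - 1)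
            (dag ((n : ℤ) - k) k (by omega) P) := by
  ext1 T
  have hTcard : T.1.card + (k + 1) = n := by
    have := T.2
    omega
  obtain ⟨σ, hσ, hσT⟩ := exists_shuffle T.1 hTcard
  let v : Fin (k + 1) → Fin n := fun l => σ (Fin.castLE hk l)
  have hv : Function.Injective v := σ.injective.comp (Fin.castLE_injective hk)
  have hvT : ∀ x, x ∉ T.1 ↔ x ∈ Set.range v := by
    intro x
    obtain ⟨p, rfl⟩ := σ.surjective x
    simp only [hσT, v, Set.mem_range, EmbeddingLike.apply_eq_iff_eq]
    constructor
    · intro h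
      exact ⟨⟨p, by omega⟩, rfl⟩
    · rintro ⟨i, rfl⟩
      simp only [Fin.val_castLE]
      omega
  rw [dag_apply hk _ T hσ hσT, hP.dlt_X a ha v, Pi.smul_apply]
  simp only [bnd, LinearMap.pi_apply, LinearMap.sum_apply, Finset.smul_sum]
  refine Fintype.sum_of_injective v hv _ _ (fun x hx => ?_) fun i => ?_
  · rw [if_pos (not_not.1 (mt (hvT x).1 hx))]
    simp
  have hvi : v i ∉ T.1 := (hvT _).2 ⟨i, rfl⟩
  have hins : ((insert (v i) T.1).card : ℤ) = (n : ℤ) - k := by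
    rw [Finset.card_insert_of_notMem hvi]
    omega
  rw [if_neg hvi, dif_pos hins]
  have hr : (T.1.filter (fun w => w < v i)).card ≤ T.1.card := Finset.card_filter_le _ _
  set r := (T.1.filter (fun w => w < v i)).card with hrdef
  let j : Fin n := ⟨k + r, by omega⟩
  have hij : Fin.castLE hk i ≤ j := by
    rw [Fin.le_def]
    simp only [Fin.val_castLE, j]
    omega
  obtain ⟨hτ, hτT⟩ := hσ.mul_cycleIcc hσT (i := Fin.castLE hk i) (j := j)
    (by simp only [Fin.val_castLE]; omega) rfl
  have hargs : ∀ l : Fin k, (σ * Fin.cycleIcc (Fin.castLE hk i) j) (Fin.castLE (by omega) l) =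
      v (i.succAbove l) := by
    intro l
    simp only [Equiv.Perm.mul_apply, v, EmbeddingLike.apply_eq_iff_eq, Fin.ext_iff,
      val_cycleIcc hij, Fin.val_castLE, val_succAbove, Fin.le_def, Fin.lt_def, j]
    grind
  simp only [LinearMap.smul_apply, LinearMap.comp_apply, LinearMap.proj_apply,
    LinearMap.add_apply, LinearMap.mulLeft_apply]
  rw [dag_apply (by omega) P ⟨insert (v i) T.1, hins⟩ hτ hτT, sgnC_mul_cycleIcc σ hij]
  simp only [hargs, map_smul, bML_apply, mul_smul_comm, smul_smul]
  rw [← sum_add_sum_mem_eq a ha T.1 v hv hvT]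
  have hsign : (-1 : ℂ) ^ (k + 1) * (-1) ^ r *
      (sgnC σ * (-1) ^ ((Fin.castLE hk i : ℕ) + (j : ℕ))) = -(sgnC σ * (-1) ^ (i : ℕ)) := by
    have hsq : ∀ m : ℕ, ((-1 : ℂ) ^ m) ^ 2 = 1 := fun m => by
      rw [← pow_mul, mul_comm, pow_mul]
      simp
    simp only [Fin.val_castLE, j, pow_add, pow_one]
    linear_combination (-sgnC σ * (-1) ^ (i : ℕ) * ((-1) ^ r) ^ 2) * hsq k
      + (-sgnC σ * (-1) ^ (i : ℕ)) * hsq r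
  generalize (P fun l => X (v (i.succAbove l))) = Q
  linear_combination (norm := module) hsign •
    (pb a (X (v i)) Q
      - (∑ l, (a (v i) l : ℂ) + ∑ w ∈ T.1, (a w (v i) : ℂ)) • (X (v i) * Q))
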